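/- arXiv:2008.12183 — 3 statements merged into one kernel-verified Lean document; each statement's English description precedes it below -/
import Mathlib

section
/- Let n, k, d be odd positive integers such that gcd(n,k)=1 and ((3^k+1)/2)·d ≡ (3^n+1)/2 (mod 3^n−1). Then the power function f(x)=x^d on the finite field F_{3^n} is perfect c-nonlinear for c = −1; equivalently, for every a, b ∈ F_{3^n} there is exactly one x ∈ F_{3^n} with (x+a)^d + x^d = b. -/
section aux
variable {F : Type*} [Field F] (σ : F →+* F)

/-- `η σ(η) = ±1` forces the sign `+` and `η = ±1`. -/
lemma aux_eta (h2 : ∀ x, σ (σ x) = x → x = 0 ∨ x = 1 ∨ x = -1)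
    (h3 : (3 : F) = 0) (η θ : F) (hθ : θ = 1 ∨ θ = -1) (h : η * σ η = θ) :
    θ = 1 ∧ (η = 1 ∨ η = -1) := by
  have hθ0 : θ ≠ 0 := by rcases hθ with rfl | rfl <;> simp
  have hη : η ≠ 0 := by rintro rfl; simp at h; exact hθ0 h.symm
  have hση : σ η ≠ 0 := by simpa using hη
  have hσθ : σ θ = θ := by rcases hθ with rfl | rfl <;> simp
  have h' : σ η * σ (σ η) = θ := by rw [← map_mul, h, hσθ]
  have : σ (σ η) = η := by
    apply mul_left_cancel₀ hση
    rw [h', ← h, mul_comm]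
  rcases h2 η this with h0 | h0 | h0
  · exact absurd h0 hη
  · subst h0; simp at h; exact ⟨h.symm, Or.inl rfl⟩
  · subst h0; simp at h; exact ⟨h.symm, Or.inr rfl⟩

/-- `σ η = - η` only for `η = 0`. -/
lemma aux_neg (h2 : ∀ x, σ (σ x) = x → x = 0 ∨ x = 1 ∨ x = -1)
    (h3 : (3 : F) = 0) (η : F) (h : σ η = - η) : η = 0 := by
  have : σ (σ η) = η := by rw [h, map_neg, h, neg_neg]
  rcases h2 η this with h0 | h0 | h0
  · exact h0
  · subst h0; simp at h; exfalso; apply one_ne_zero (α := F); linear_combination h3 - h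
  · subst h0; simp at h; exfalso; apply one_ne_zero (α := F); linear_combination h3 + h

lemma aux_T (h2 : ∀ x, σ (σ x) = x → x = 0 ∨ x = 1 ∨ x = -1)
    (h3 : (3 : F) = 0) (r s : F) (h : r * σ s + s * σ r = 0) : r = 0 ∨ s = 0 := by
  by_cases hs : s = 0
  · exact Or.inr hs
  left
  have hss : σ s ≠ 0 := by simpa using hs
  have : r / s = 0 := by
    apply aux_neg σ h2 h3
    rw [map_div₀]
    field_simp
    linear_combination h
  simpa [hs] using this

lemma aux_pm (h2 : ∀ x, σ (σ x) = x → x = 0 ∨ x = 1 ∨ x = -1)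
    (h3 : (3 : F) = 0) (p p' θ : F) (hp : p ≠ 0) (hθ : θ = 1 ∨ θ = -1)
    (h : p' * σ p' = θ * (p * σ p)) : θ = 1 ∧ (p' = p ∨ p' = -p) := by
  have hsp : σ p ≠ 0 := by simpa using hp
  have := aux_eta σ h2 h3 (p' / p) θ hθ (by
    rw [map_div₀]; field_simp; linear_combination h)
  refine ⟨this.1, ?_⟩
  rcases this.2 with h | h
  · left; field_simp at h; exact h
  · right; field_simp at h; exact h

lemma aux_same (h2 : ∀ x, σ (σ x) = x → x = 0 ∨ x = 1 ∨ x = -1)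
    (h3 : (3 : F) = 0) (a b ε ε' r s r' s' : F) (hb : b ≠ 0)
    (hε : ε = 1 ∨ ε = -1) (hε' : ε' = 1 ∨ ε' = -1)
    (h : r ^ 2 - s ^ 2 = ε * b) (ha : r * σ r + s * σ s = ε * a)
    (h' : r' ^ 2 - s' ^ 2 = ε' * b) (ha' : r' * σ r' + s' * σ s' = ε' * a) :
    ε * (r * σ r) = ε' * (r' * σ r') := by
  have e1 : ε ^ 2 = 1 := by rcases hε with rfl | rfl <;> simp
  have e1' : ε' ^ 2 = 1 := by rcases hε' with rfl | rfl <;> simp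
  have hθ : ε * ε' = 1 ∨ ε * ε' = -1 := by
    rcases hε with rfl | rfl <;> rcases hε' with rfl | rfl <;> simp
  have e0 : ε ≠ 0 := by rintro rfl; simp at e1
  have hσε : σ ε = ε := by rcases hε with rfl | rfl <;> simp
  have hσε' : σ ε' = ε' := by rcases hε' with rfl | rfl <;> simp
  have hpm : (r + s) * (r - s) = ε * b := by linear_combination h
  have hpm' : (r' + s') * (r' - s') = ε' * b := by linear_combination h'
  have hp : r + s ≠ 0 := by
    intro h0; rw [h0, zero_mul] at hpm; exact mul_ne_zero e0 hb hpm.symm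
  have hm : r - s ≠ 0 := by
    intro h0; rw [h0, mul_zero] at hpm; exact mul_ne_zero e0 hb hpm.symm
  have hs := congrArg σ hpm
  have hs' := congrArg σ hpm'
  simp only [map_mul, map_add, map_sub, hσε, hσε'] at hs hs'
  have key : ((r' + s') * σ (r' + s') - ε * ε' * ((r + s) * σ (r + s))) *
      ((r' + s') * σ (r' + s') - ε * ε' * ((r - s) * σ (r - s))) = 0 := by
    simp only [map_add, map_sub]
    have i1 : (r + s) * (σ r + σ s) + (r - s) * (σ r - σ s) = 2 * ε * a := by
      linear_combination 2 * ha
    have i1' : (r' + s') * (σ r' + σ s') + (r' - s') * (σ r' - σ s') = 2 * ε' * a := by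
      linear_combination 2 * ha'
    have i2 : ((r + s) * (σ r + σ s)) * ((r - s) * (σ r - σ s)) = b * σ b := by
      linear_combination ((σ r + σ s) * (σ r - σ s)) * hpm + ε * b * hs + b * σ b * e1
    have i2' : ((r' + s') * (σ r' + σ s')) * ((r' - s') * (σ r' - σ s')) = b * σ b := by
      linear_combination ((σ r' + σ s') * (σ r' - σ s')) * hpm' + ε' * b * hs' + b * σ b * e1'
    generalize (r + s) * (σ r + σ s) = P at *
    generalize (r - s) * (σ r - σ s) = M at *
    generalize (r' + s') * (σ r' + σ s') = P' at *
    generalize (r' - s') * (σ r' - σ s') = M' at *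
    have i3 : ε * ε' * (P + M) = P' + M' := by
      linear_combination ε * ε' * i1 - i1' + 2 * ε' * a * e1
    have i4 : P * M = P' * M' := by rw [i2, i2']
    linear_combination (-P') * i3 + i4 + P * M * ε' ^ 2 * e1 + P * M * e1'
  have two : (2 : F) ≠ 0 := by
    intro h0; apply one_ne_zero (α := F); linear_combination h3 - h0
  have fin : ∀ t : F, ε = ε' → (t = r ∨ t = -r) → r' = t → 
      ε * (r * σ r) = ε' * (r' * σ r') := by
    rintro t rfl (rfl | rfl) rfl <;> simp
  have hee : ε * ε' = 1 → ε = ε' := by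
    intro h; linear_combination ε' * h - ε * e1'
  rcases mul_eq_zero.1 key with k | k
  · obtain ⟨hh, h5⟩ := aux_pm σ h2 h3 (r + s) (r' + s') _ hp hθ (sub_eq_zero.1 k)
    have hh := hee hh
    subst hh
    rcases h5 with h5 | h5
    · have : r' - s' = r - s := by
        apply mul_left_cancel₀ hp; rw [hpm, ← h5, hpm']
      exact fin r rfl (Or.inl rfl) (mul_left_cancel₀ two (by linear_combination h5 + this))
    · have : r' - s' = -(r - s) := by
        apply mul_left_cancel₀ hp; rw [mul_neg, hpm, ← hpm', h5]; ring
      exact fin (-r) rfl (Or.inr rfl) (mul_left_cancel₀ two (by linear_combination h5 + this))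
  · obtain ⟨hh, h5⟩ := aux_pm σ h2 h3 (r - s) (r' + s') _ hm hθ (sub_eq_zero.1 k)
    have hh := hee hh
    subst hh
    rcases h5 with h5 | h5
    · have : r' - s' = r + s := by
        apply mul_left_cancel₀ hm; rw [mul_comm (r - s) (r + s), hpm, ← h5, hpm']
      exact fin r rfl (Or.inl rfl) (mul_left_cancel₀ two (by linear_combination h5 + this))
    · have : r' - s' = -(r + s) := by
        apply mul_left_cancel₀ hm
        rw [mul_neg, mul_comm (r - s) (r + s), hpm, ← hpm', h5]; ring
      exact fin (-r) rfl (Or.inr rfl) (mul_left_cancel₀ two (by linear_combination h5 + this))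

lemma aux_mixed (h2 : ∀ x, σ (σ x) = x → x = 0 ∨ x = 1 ∨ x = -1)
    (h3 : (3 : F) = 0) (a b ε ε' r s r' s' : F) (hb : b ≠ 0)
    (hε : ε = 1 ∨ ε = -1) (hε' : ε' = 1 ∨ ε' = -1)
    (h : r ^ 2 + s ^ 2 = ε * b) (ha : r * σ r - s * σ s = ε * a)
    (h' : r' ^ 2 + s' ^ 2 = ε' * b) (ha' : r' * σ r' - s' * σ s' = ε' * a) :
    ε * (r * σ r) = ε' * (r' * σ r') := by
  have e1 : ε ^ 2 = 1 := by rcases hε with rfl | rfl <;> simp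
  have e1' : ε' ^ 2 = 1 := by rcases hε' with rfl | rfl <;> simp
  have hσε : σ ε = ε := by rcases hε with rfl | rfl <;> simp
  have hσε' : σ ε' = ε' := by rcases hε' with rfl | rfl <;> simp
  have e0 : ε ≠ 0 := by rintro rfl; simp at e1
  have hs := congrArg σ h
  have hs' := congrArg σ h'
  simp only [map_mul, map_add, map_pow, hσε, hσε'] at hs hs'
  -- reduce to the case of matching imaginary parts
  suffices H : ∀ s', r' ^ 2 + s' ^ 2 = ε' * b → r' * σ r' - s' * σ s' = ε' * a →
      σ r' ^ 2 + σ s' ^ 2 = ε' * σ b →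
      r' * σ s' + s' * σ r' = ε * ε' * (r * σ s + s * σ r) → 
      ε * (r * σ r) = ε' * (r' * σ r') by
    have sq : (r' * σ s' + s' * σ r') ^ 2 = (ε * ε' * (r * σ s + s * σ r)) ^ 2 := by
      have i : (r * σ s + s * σ r) ^ 2 = b * σ b - a ^ 2 := by
        linear_combination (σ r ^ 2 + σ s ^ 2) * h + ε * b * hs + b * σ b * e1
          - (r * σ r - s * σ s + ε * a) * ha - a ^ 2 * e1
      have i' : (r' * σ s' + s' * σ r') ^ 2 = b * σ b - a ^ 2 := by
        linear_combination (σ r' ^ 2 + σ s' ^ 2) * h' + ε' * b * hs' + b * σ b * e1'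
          - (r' * σ r' - s' * σ s' + ε' * a) * ha' - a ^ 2 * e1'
      rw [mul_pow, i, i', mul_pow, e1, e1']; ring
    rcases sq_eq_sq_iff_eq_or_eq_neg.1 sq with q | q
    · exact H s' h' ha' hs' q
    · refine H (-s') (by linear_combination h') (by rw [map_neg]; linear_combination ha')
        (by rw [map_neg]; linear_combination hs') (by rw [map_neg]; linear_combination -q)
  clear ha' h' hs'
  intro s' h' ha' hs' hS
  have hC : r' * σ r' - s' * σ s' = ε * ε' * (r * σ r - s * σ s) := by
    rw [ha, ha']; linear_combination -ε' * a * e1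
  have hN : ε * b ≠ 0 := mul_ne_zero e0 hb
  have hσb : σ b ≠ 0 := by simpa using hb
  -- σ(ω') N' = (ω' σ ω') conj ω'
  have j1 : ε * b * σ r' = r' * (r * σ r - s * σ s) + s' * (r * σ s + s * σ r) := by
    linear_combination (-ε * ε' * σ r') * h' + (ε * ε') * (r' * hC + s' * hS)
      - (ε * b * σ r') * e1' + (r' * (r * σ r - s * σ s) + s' * (r * σ s + s * σ r)) * (ε' ^ 2 * e1 + e1')
  have j2 : ε * b * σ s' = r' * (r * σ s + s * σ r) - s' * (r * σ r - s * σ s) := by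
    linear_combination (-ε * ε' * σ s') * h' + (ε * ε') * (r' * hS - s' * hC)
      - (ε * b * σ s') * e1' + (r' * (r * σ s + s * σ r) - s' * (r * σ r - s * σ s)) * (ε' ^ 2 * e1 + e1')
  have kA : σ (r' * r + s' * s) * b = σ b * (r' * r + s' * s) := by
    simp only [map_add, map_mul]
    apply mul_left_cancel₀ e0
    linear_combination σ r * j1 + σ s * j2 + (r' * r + s' * s) * hs
  have kB : σ (s' * r - r' * s) * b = - (σ b * (s' * r - r' * s)) := by
    simp only [map_sub, map_mul]
    apply mul_left_cancel₀ e0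
    linear_combination σ r * j2 - σ s * j1 - (s' * r - r' * s) * hs
  have B0 : (s' * r - r' * s) / b = 0 := by
    apply aux_neg σ h2 h3
    rw [map_div₀]; field_simp; linear_combination kB
  have B1 : s' * r - r' * s = 0 := by simpa [hb] using B0
  have A0 : σ ((r' * r + s' * s) / b) = (r' * r + s' * s) / b := by
    rw [map_div₀]; field_simp; linear_combination kA
  have A1 := h2 ((r' * r + s' * s) / b) (by rw [A0, A0])
  have nrm : (r' * r + s' * s) ^ 2 = ε * ε' * b ^ 2 := by
    linear_combination (r ^ 2 + s ^ 2) * h' + ε' * b * h - (s' * r - r' * s) * B1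
  have A2 : ε * ε' = 1 ∧ ((r' * r + s' * s) = b ∨ (r' * r + s' * s) = -b) := by
    have b2 : b ^ 2 ≠ 0 := pow_ne_zero _ hb
    rcases A1 with h0 | h0 | h0 <;> field_simp at h0
    · exfalso
      rw [h0] at nrm
      apply b2
      linear_combination (-ε * ε') * nrm - b ^ 2 * (ε' ^ 2 * e1 + e1')
    · refine ⟨mul_right_cancel₀ b2 ?_, Or.inl h0⟩
      rw [← nrm, h0]; ring
    · refine ⟨mul_right_cancel₀ b2 ?_, Or.inr (by rw [h0])⟩
      rw [← nrm, h0]; ring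
  obtain ⟨hh, A3⟩ := A2
  have hee : ε = ε' := by linear_combination ε' * hh - ε * e1'
  subst hee
  have fin : r' = ε * r ∨ r' = -(ε * r) := by
    rcases A3 with A3 | A3
    · left; apply mul_left_cancel₀ hN
      linear_combination -r' * h + r * A3 - s * B1 - r * b * e1
    · right; apply mul_left_cancel₀ hN
      linear_combination -r' * h + r * A3 - s * B1 + r * b * e1
  rcases fin with rfl | rfl
  · rw [map_mul, hσε]; linear_combination -ε * r * σ r * e1
  · rw [map_neg, map_mul, hσε]; linear_combination -ε * r * σ r * e1

lemma aux_cross (h2 : ∀ x, σ (σ x) = x → x = 0 ∨ x = 1 ∨ x = -1)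
    (h3 : (3 : F) = 0) (hsq : ∀ x y : F, x ^ 2 + y ^ 2 = 0 → x = 0)
    (a b ε ε' r s r' s' : F) (hb : b ≠ 0)
    (hε : ε = 1 ∨ ε = -1) (hε' : ε' = 1 ∨ ε' = -1)
    (h : r ^ 2 - s ^ 2 = ε * b) (ha : r * σ r + s * σ s = ε * a)
    (h' : r' ^ 2 + s' ^ 2 = ε' * b) (ha' : r' * σ r' - s' * σ s' = ε' * a) :
    ε * (r * σ r) = ε' * (r' * σ r') := by
  have e1 : ε ^ 2 = 1 := by rcases hε with rfl | rfl <;> simp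
  have e1' : ε' ^ 2 = 1 := by rcases hε' with rfl | rfl <;> simp
  have hσε : σ ε = ε := by rcases hε with rfl | rfl <;> simp
  have hσε' : σ ε' = ε' := by rcases hε' with rfl | rfl <;> simp
  have hs := congrArg σ h
  have hs' := congrArg σ h'
  simp only [map_mul, map_add, map_sub, map_pow, hσε, hσε'] at hs hs'
  have i : (r * σ s + s * σ r) ^ 2 = a ^ 2 - b * σ b := by
    linear_combination -(σ r ^ 2 - σ s ^ 2) * h - ε * b * hs - b * σ b * e1
      + (r * σ r + s * σ s + ε * a) * ha + a ^ 2 * e1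
  have i' : (r' * σ s' + s' * σ r') ^ 2 = b * σ b - a ^ 2 := by
    linear_combination (σ r' ^ 2 + σ s' ^ 2) * h' + ε' * b * hs' + b * σ b * e1'
      - (r' * σ r' - s' * σ s' + ε' * a) * ha' - a ^ 2 * e1'
  have T := hsq _ _ (show (r * σ s + s * σ r) ^ 2 + (r' * σ s' + s' * σ r') ^ 2 = 0 by
    rw [i, i']; ring)
  rcases aux_T σ h2 h3 r s T with rfl | rfl
  · have := aux_mixed σ h2 h3 a b (-ε) ε' 0 s r' s' hb
      (by rcases hε with rfl | rfl <;> simp) hε'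
      (by linear_combination -h) (by linear_combination -ha) h' ha'
    simpa using this
  · exact aux_mixed σ h2 h3 a b ε ε' r 0 r' s' hb hε hε'
      (by linear_combination h) (by simpa using ha) h' ha'

/-- Injectivity in parametrised form. -/
lemma aux_main (h2 : ∀ x, σ (σ x) = x → x = 0 ∨ x = 1 ∨ x = -1)
    (h3 : (3 : F) = 0) (hsq : ∀ x y : F, x ^ 2 + y ^ 2 = 0 → x = 0)
    (a b ε δ ε' δ' r s r' s' : F) (hb : b ≠ 0)
    (hε : ε = 1 ∨ ε = -1) (hε' : ε' = 1 ∨ ε' = -1)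
    (hδ : δ = 1 ∨ δ = -1) (hδ' : δ' = 1 ∨ δ' = -1)
    (h : ε * r ^ 2 + δ * s ^ 2 = b) (ha : ε * (r * σ r) - δ * (s * σ s) = a)
    (h' : ε' * r' ^ 2 + δ' * s' ^ 2 = b) (ha' : ε' * (r' * σ r') - δ' * (s' * σ s') = a) :
    ε * (r * σ r) = ε' * (r' * σ r') := by
  have c : ∀ ε δ r s : F, (ε = 1 ∨ ε = -1) → (δ = 1 ∨ δ = -1) → ε * r ^ 2 + δ * s ^ 2 = b →
      ε * (r * σ r) - δ * (s * σ s) = a → 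
      (r ^ 2 - s ^ 2 = ε * b ∧ r * σ r + s * σ s = ε * a) ∨
      (r ^ 2 + s ^ 2 = ε * b ∧ r * σ r - s * σ s = ε * a) := by
    rintro ε δ r s (rfl | rfl) (rfl | rfl) rfl rfl
    · right; constructor <;> ring
    · left; constructor <;> ring
    · left; constructor <;> ring
    · right; constructor <;> ring
  rcases c ε δ r s hε hδ h ha with ⟨p, q⟩ | ⟨p, q⟩ <;>
    rcases c ε' δ' r' s' hε' hδ' h' ha' with ⟨p', q'⟩ | ⟨p', q'⟩
  · exact aux_same σ h2 h3 a b ε ε' r s r' s' hb hε hε' p q p' q'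
  · exact aux_cross σ h2 h3 hsq a b ε ε' r s r' s' hb hε hε' p q p' q'
  · exact (aux_cross σ h2 h3 hsq a b ε' ε r' s' r s hb hε' hε p' q' p q).symm
  · exact aux_mixed σ h2 h3 a b ε ε' r s r' s' hb hε hε' p q p' q'

end aux

/-- Theorem 3.1 (Theorem `thmf`): Let `n, k, d` be odd positive integers with
`gcd(n,k) = 1` and `((3^k+1)/2) * d ≡ (3^n+1)/2 (mod 3^n - 1)`. Then the power
function `f(x) = x^d` on `F_{3^n}` is PcN for `c = -1`: for every `a, b` there is
exactly one `x` with `(x+a)^d + x^d = b`. -/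
theorem stmt_0 (n k d : ℕ) (hn0 : 0 < n) (hk0 : 0 < k) (hd0 : 0 < d)
    (hn : Odd n) (hk : Odd k) (hd : Odd d) (hgcd : Nat.gcd n k = 1)
    (hcong : ((3 ^ k + 1) / 2) * d ≡ (3 ^ n + 1) / 2 [MOD 3 ^ n - 1])
    (F : Type*) [Field F] [Fintype F] (hcard : Fintype.card F = 3 ^ n)
    (a b : F) :
    ∃! x : F, (x + a) ^ d + x ^ d = b := by
  haveI : Fact (Nat.Prime 3) := ⟨Nat.prime_three⟩
  haveI : CharP F 3 := charP_of_card_eq_prime_pow hcard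
  have h3 : (3 : F) = 0 := by exact_mod_cast CharP.cast_eq_zero F 3
  have two : (2 : F) ≠ 0 := by
    intro h0; apply one_ne_zero (α := F); linear_combination h3 - h0
  have mod4 : 3 ^ n % 4 = 3 := by
    obtain ⟨m, rfl⟩ := hn
    rw [pow_add, pow_mul]; norm_num [Nat.mul_mod, Nat.pow_mod]
  have hns : ¬ IsSquare (-1 : F) := by
    rw [FiniteField.isSquare_neg_one_iff, hcard]; simp [mod4]
  have hsq : ∀ x y : F, x ^ 2 + y ^ 2 = 0 → x = 0 := by
    intro x y h
    by_contra hx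
    apply hns
    refine ⟨y / x, ?_⟩
    field_simp
    linear_combination -h
  have hpm : ∀ x : F, ∃ ε t : F, (ε = 1 ∨ ε = -1) ∧ x = ε * t ^ 2 := by
    intro x
    have hF : ringChar F ≠ 2 := by
      rw [ringChar.eq F 3]; norm_num
    by_cases hx : x = 0
    · exact ⟨1, 0, Or.inl rfl, by simp [hx]⟩
    have hdi := FiniteField.pow_dichotomy hF hx
    rw [hcard] at hdi
    have hx2 : (x ^ ((3 ^ n + 1) / 4)) ^ 2 = x * x ^ (3 ^ n / 2) := by
      rw [← pow_mul, ← pow_succ']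
      congr 1
      omega
    rcases hdi with e | e
    · exact ⟨1, _, Or.inl rfl, by rw [hx2, e]; ring⟩
    · exact ⟨-1, _, Or.inr rfl, by rw [hx2, e]; ring⟩
  set σ : F →+* F := iterateFrobenius F 3 k with hσ
  have hσa : ∀ x, σ x = x ^ 3 ^ k := fun x => iterateFrobenius_def _ _ _
  have h2 : ∀ x, σ (σ x) = x → x = 0 ∨ x = 1 ∨ x = -1 := by
    intro x hx
    have p1 : Function.IsPeriodicPt (frobenius F 3) (k + k) x := by
      unfold Function.IsPeriodicPt Function.IsFixedPt
      rw [← coe_iterateFrobenius, iterateFrobenius_def, pow_add, pow_mul, ← hσa, ← hσa, hx]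
    have p2 : Function.IsPeriodicPt (frobenius F 3) n x := by
      unfold Function.IsPeriodicPt Function.IsFixedPt
      rw [← coe_iterateFrobenius, iterateFrobenius_def, ← hcard, FiniteField.pow_card]
    have g : Nat.gcd (k + k) n = 1 := by
      rw [← two_mul]
      apply Nat.Coprime.mul_left
      · exact (Nat.coprime_two_left).2 hn
      · exact Nat.Coprime.symm hgcd
    have p3 := p1.gcd p2
    rw [g] at p3
    have p4 : x ^ 3 = x := by simpa [Function.IsPeriodicPt, Function.IsFixedPt, frobenius_def] using p3
    have : x * ((x - 1) * (x + 1)) = 0 := by linear_combination p4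
    rcases mul_eq_zero.1 this with h | h
    · exact Or.inl h
    rcases mul_eq_zero.1 h with h | h
    · exact Or.inr (Or.inl (sub_eq_zero.1 h))
    · exact Or.inr (Or.inr (eq_neg_of_add_eq_zero_left h))
  -- parametrisation
  have par : ∀ x : F, ∃ ε r : F, (ε = 1 ∨ ε = -1) ∧ x = ε * (r * σ r) ∧ x ^ d = ε * r ^ 2 := by
    intro x
    obtain ⟨ε, t, hε, rfl⟩ := hpm x
    refine ⟨ε, t ^ d, hε, ?_, ?_⟩
    · congr 1
      rw [hσa, ← pow_succ', ← pow_mul]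
      by_cases ht : t = 0
      · subst ht
        rw [zero_pow two_ne_zero, zero_pow]
        positivity
      have t1 : t ^ (3 ^ n - 1) = 1 := by
        rw [← hcard]; exact FiniteField.pow_card_sub_one_eq_one t ht
      have c2 : d * (3 ^ k + 1) ≡ 3 ^ n + 1 [MOD 3 ^ n - 1] := by
        have := hcong.mul_left 2
        have o1 : Odd (3 ^ k) := Odd.pow (by decide)
        have o2 : Odd (3 ^ n) := Odd.pow (by decide)
        have e1 : 2 * ((3 ^ k + 1) / 2) = 3 ^ k + 1 := by
          rcases o1 with ⟨m, hm⟩; omega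
        have e2 : 2 * ((3 ^ n + 1) / 2) = 3 ^ n + 1 := by
          rcases o2 with ⟨m, hm⟩; omega
        rwa [← mul_assoc, e1, e2, mul_comm] at this
      have c3 : 3 ^ n + 1 ≡ 2 [MOD 3 ^ n - 1] := by
        have hpos : 1 ≤ 3 ^ n := Nat.one_le_pow _ _ (by norm_num)
        clear_value σ
        generalize 3 ^ n = q at hpos
        have : q + 1 = 2 + (q - 1) := by omega
        rw [this]; exact Nat.add_modEq_right
      exact (pow_eq_pow_of_modEq (c2.trans c3) t1).symm
    · rw [mul_pow]
      congr 1
      · rcases hε with rfl | rfl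
        · simp
        · exact hd.neg_one_pow
      · ring
  have inj : Function.Injective (fun x : F => (x + a) ^ d + x ^ d) := by
    intro x y hxy
    simp only at hxy
    obtain ⟨ε, r, hε, hr, hrd⟩ := par (x + a)
    obtain ⟨δ, s, hδ, hs, hsd⟩ := par x
    obtain ⟨ε', r', hε', hr', hrd'⟩ := par (y + a)
    obtain ⟨δ', s', hδ', hs', hsd'⟩ := par y
    by_cases hb : (x + a) ^ d + x ^ d = 0
    · have z : ∀ x : F, (x + a) ^ d + x ^ d = 0 → x + a = - x := by
        intro x hb
        obtain ⟨ε, r, hε, hr, hrd⟩ := par (x + a)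
        obtain ⟨δ, s, hδ, hs, hsd⟩ := par x
        have hb' := hb
        rw [hrd, hsd] at hb'
        have same : ∀ η : F, r ^ 2 + s ^ 2 = 0 → η * (r * σ r) = - (η * (s * σ s)) := by
          intro η h
          have r0 := hsq _ _ h
          have s0 := hsq s r (by rw [add_comm]; exact h)
          simp [r0, s0]
        have opp : ∀ η : F, r ^ 2 = s ^ 2 → η * (r * σ r) = η * (s * σ s) := by
          intro η h
          rcases sq_eq_sq_iff_eq_or_eq_neg.1 h with rfl | rfl <;> simp
        rw [hr]
        conv_rhs => rw [hs]
        rcases hε with rfl | rfl <;> rcases hδ with rfl | rfl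
        · exact same 1 (by linear_combination hb')
        · rw [opp 1 (by linear_combination hb')]; ring
        · rw [opp (-1) (by linear_combination -hb')]; ring
        · exact same (-1) (by linear_combination -hb')
      have z1 := z x hb
      have z2 := z y (hxy ▸ hb)
      exact mul_left_cancel₀ two (by linear_combination z1 - z2)
    · have := aux_main σ h2 h3 hsq a ((x + a) ^ d + x ^ d) ε δ ε' δ' r s r' s' hb hε hε' hδ hδ'
        (by rw [hrd, hsd]) (by rw [← hr, ← hs]; ring) (by rw [hxy, hrd', hsd'])
        (by rw [← hr', ← hs']; ring)
      rw [← hr, ← hr'] at this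
      exact add_right_cancel this
  obtain ⟨x, hx⟩ := (Finite.injective_iff_surjective.1 inj) b
  exact ⟨x, hx, fun y hy => inj (hy.trans hx.symm)⟩
end

section
/- Let d be an odd positive integer and let n, k be positive integers such that gcd(2n,k)=1 and ((5^k+1)/2)·d ≡ (5^n+1)/2 (mod 5^n−1). Then the power function f(x)=x^d on the finite field F_{5^n} is perfect c-nonlinear for c = −1; equivalently, for every a, b ∈ F_{5^n} there is exactly one x ∈ F_{5^n} with (x+a)^d + x^d = b. -/
lemma aux_pow25 (j : ℕ) : ∃ u, 25 ^ j = 24 * u + 1 := by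
  induction j with
  | zero => exact ⟨0, by norm_num⟩
  | succ j ih =>
    obtain ⟨u, hu⟩ := ih
    exact ⟨25 * u + 1, by rw [pow_succ, hu]; ring⟩

lemma aux_odd_pow (k : ℕ) (hk : Odd k) : ∃ u, 5 ^ k = 120 * u + 5 := by
  obtain ⟨j, rfl⟩ := hk
  obtain ⟨u, hu⟩ := aux_pow25 j
  exact ⟨u, by rw [pow_succ, pow_mul]; norm_num [hu]; ring⟩

lemma aux_n_odd (n k d : ℕ) (hk : Odd k)
    (hcong : ((5 ^ k + 1) / 2) * d ≡ (5 ^ n + 1) / 2 [MOD 5 ^ n - 1]) : Odd n := by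
  by_contra h
  rw [Nat.not_odd_iff_even] at h
  obtain ⟨j, rfl⟩ := h
  obtain ⟨u, hu⟩ := aux_odd_pow k hk
  obtain ⟨w, hw⟩ := aux_pow25 j
  have h5 : 5 ^ (j + j) = 24 * w + 1 := by
    rw [← hw, ← two_mul, pow_mul]; norm_num
  rw [hu, h5] at hcong
  have h3 : 3 ∣ 24 * w + 1 - 1 := ⟨8 * w, by omega⟩
  have h := hcong.of_dvd h3
  have e1 : (120 * u + 5 + 1) / 2 = 3 * (20 * u + 1) := by omega
  have e2 : (24 * w + 1 + 1) / 2 = 12 * w + 1 := by omega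
  rw [e1, e2, mul_assoc] at h
  unfold Nat.ModEq at h
  omega

lemma aux_coprime (n k M : ℕ) (hk : Odd k) (hn : Odd n) (hgcd : Nat.gcd (2 * n) k = 1)
    (hM : 2 * M = 5 ^ k + 5 ^ n) : Nat.Coprime M (5 ^ (2 * n) - 1) := by
  obtain ⟨u, hu⟩ := aux_odd_pow k hk
  obtain ⟨w, hw⟩ := aux_odd_pow n hn
  have hM' : M = 60 * (u + w) + 5 := by omega
  refine Nat.Coprime.symm (Nat.coprime_of_dvd ?_)
  intro p hp h1 h2
  haveI := Fact.mk hp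
  have hz : (5 : ZMod p) ^ (2 * n) = 1 := by
    have := (ZMod.natCast_eq_zero_iff (5 ^ (2 * n) - 1) p).2 h1
    rw [Nat.cast_sub (Nat.one_le_pow _ _ (by norm_num))] at this
    push_cast at this
    exact sub_eq_zero.1 this
  have hs : (5 : ZMod p) ^ k + 5 ^ n = 0 := by
    have := (ZMod.natCast_eq_zero_iff (2 * M) p).2 (Dvd.dvd.mul_left h2 2)
    rw [hM] at this
    exact_mod_cast this
  have hk2 : (5 : ZMod p) ^ (2 * k) = 1 := by
    have e : (5 : ZMod p) ^ k = - 5 ^ n := eq_neg_of_add_eq_zero_left hs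
    rw [mul_comm, pow_mul, e, neg_sq, ← pow_mul, mul_comm, hz]
  have hg : Nat.gcd (2 * n) (2 * k) = 2 := by
    rw [Nat.gcd_mul_left]
    have : Nat.gcd n k = 1 := Nat.Coprime.coprime_mul_left (k := 2) hgcd
    omega
  have h25 : (5 : ZMod p) ^ 2 = 1 := by
    rw [← hg]
    exact pow_gcd_eq_one.2 ⟨hz, hk2⟩
  have h24 : p ∣ 24 := by
    rw [← ZMod.natCast_eq_zero_iff]
    push_cast
    linear_combination h25
  have h24' : p ∣ 2 ^ 3 * 3 := by simpa using h24
  rcases (hp.dvd_mul).1 h24' with h | h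
  · have := hp.dvd_of_dvd_pow h
    rw [Nat.prime_dvd_prime_iff_eq hp Nat.prime_two] at this
    subst this
    omega
  · rw [Nat.prime_dvd_prime_iff_eq hp Nat.prime_three] at h
    subst h
    omega

lemma aux_exists_t {K : Type*} [Field K] [IsAlgClosed K] (v : K) :
    ∃ t : K, t ≠ 0 ∧ t ^ 2 + 1 = 2 * v * t := by
  obtain ⟨s, hs⟩ := IsAlgClosed.exists_pow_nat_eq (v ^ 2 - 1) (n := 2) (by norm_num)
  have h : (v + s) ^ 2 + 1 = 2 * v * (v + s) := by linear_combination hs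
  refine ⟨v + s, ?_, h⟩
  intro h0
  rw [h0] at h
  norm_num at h

lemma aux_t_pow {K : Type*} [Field K] [CharP K 5] (n : ℕ) (v t : K) (hv : v ^ 5 ^ n = v)
    (ht0 : t ≠ 0) (ht : t ^ 2 + 1 = 2 * v * t) : t ^ (5 ^ (2 * n) - 1) = 1 := by
  haveI : Fact (Nat.Prime 5) := ⟨by norm_num⟩
  haveI : ExpChar K 5 := ExpChar.prime (by norm_num)
  have h2 : (2 : K) ^ 5 ^ n = 2 := by
    have := map_ofNat (iterateFrobenius K 5 n) 2
    rwa [iterateFrobenius_def] at this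
  have hq : (t ^ 5 ^ n) ^ 2 + 1 = 2 * v * t ^ 5 ^ n := by
    have := congrArg (iterateFrobenius K 5 n) ht
    simp only [map_add, map_mul, map_pow, map_one, iterateFrobenius_def] at this
    rwa [h2, hv] at this
  have hf : (t ^ 5 ^ n - t) * (t ^ 5 ^ n * t - 1) = 0 := by
    linear_combination t * hq - t ^ 5 ^ n * ht
  have key : t ^ 5 ^ (2 * n) = t := by
    have e : t ^ 5 ^ (2 * n) = (t ^ 5 ^ n) ^ 5 ^ n := by
      rw [← pow_mul, ← pow_add, two_mul]
    rw [e]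
    rcases mul_eq_zero.1 hf with h | h
    · have h' : t ^ 5 ^ n = t := sub_eq_zero.1 h
      rw [h', h']
    · have h' : t ^ 5 ^ n = t⁻¹ := eq_inv_of_mul_eq_one_left (sub_eq_zero.1 h)
      rw [h', inv_pow, h', inv_inv]
  apply mul_right_cancel₀ ht0
  rw [← pow_succ, Nat.sub_add_cancel (Nat.one_le_pow _ _ (by norm_num)), key, one_mul]

lemma aux_dickson {K : Type*} [Field K] [CharP K 5] (n k M : ℕ)
    (hM : 2 * M = 5 ^ k + 5 ^ n) (v t : K) 
    (ht : t ^ 2 + 1 = 2 * v * t) :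
    (2 * t) ^ M * ((v + 1) ^ M + (v - 1) ^ M) = 2 * ((t ^ M) ^ 2 + 1) := by
  haveI : Fact (Nat.Prime 5) := ⟨by norm_num⟩
  haveI : ExpChar K 5 := ExpChar.prime (by norm_num)
  have e1 : 2 * t * (v + 1) = (t + 1) ^ 2 := by linear_combination -ht
  have e2 : 2 * t * (v - 1) = (t - 1) ^ 2 := by linear_combination -ht
  rw [mul_add, ← mul_pow, ← mul_pow, e1, e2, ← pow_mul, ← pow_mul, hM, pow_add, pow_add,
    add_pow_expChar_pow, add_pow_expChar_pow, sub_pow_expChar_pow, sub_pow_expChar_pow,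
    ← pow_mul, mul_comm M 2, hM, pow_add]
  simp only [one_pow]
  ring

lemma aux_inj_K {K : Type*} [Field K] [IsAlgClosed K] [CharP K 5] (n k M : ℕ)
    (hM : 2 * M = 5 ^ k + 5 ^ n) (hco : Nat.Coprime M (5 ^ (2 * n) - 1))
    (v w : K) (hv : v ^ 5 ^ n = v) (hw : w ^ 5 ^ n = w)
    (h : (v + 1) ^ M + (v - 1) ^ M = (w + 1) ^ M + (w - 1) ^ M) : v = w := by
  have h20 : (2 : K) ≠ 0 := by
    intro h
    have := (CharP.cast_eq_zero_iff K 5 2).1 (by exact_mod_cast h)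
    omega
  obtain ⟨t, ht0, ht⟩ := aux_exists_t v
  obtain ⟨s, hs0, hs⟩ := aux_exists_t w
  have pt := aux_t_pow n v t hv ht0 ht
  have ps := aux_t_pow n w s hw hs0 hs
  have dt := aux_dickson n k M hM v t ht
  have ds := aux_dickson n k M hM w s hs
  have key : (t ^ M - s ^ M) * (t ^ M * s ^ M - 1) = 0 := by
    rw [mul_pow] at dt ds
    have h2 : (2 : K) * ((t ^ M - s ^ M) * (t ^ M * s ^ M - 1)) = 0 := by
      linear_combination (t^M) * ds - (s^M) * dt + (2^M * t^M * s^M) * h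
    exact (mul_eq_zero.1 h2).resolve_left h20
  have uniq : ∀ z : K, z ^ M = 1 → z ^ (5 ^ (2 * n) - 1) = 1 → z = 1 := by
    intro z h1 h2
    have := pow_gcd_eq_one.2 ⟨h1, h2⟩
    rwa [Nat.Coprime.gcd_eq_one hco, pow_one] at this
  have hts : t = s ∨ t * s = 1 := by
    rcases mul_eq_zero.1 key with h | h
    · left
      have := uniq (t / s) (by rw [div_pow, sub_eq_zero.1 h, div_self (pow_ne_zero _ hs0)])
        (by rw [div_pow, pt, ps, div_one])
      rwa [div_eq_one_iff_eq hs0] at this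
    · right
      exact uniq (t * s) (by rw [mul_pow, sub_eq_zero.1 h]) (by rw [mul_pow, pt, ps, one_mul])
  have hne : 2 * t * s ≠ 0 := mul_ne_zero (mul_ne_zero h20 ht0) hs0
  apply mul_left_cancel₀ hne
  rcases hts with h | h
  · subst h
    linear_combination t * hs - t * ht
  · linear_combination t * hs - s * ht + (t - s) * h

/-- Theorem 3.2 (Theorem `thmg`): Let `d` be odd and `n, k` positive integers with
`gcd(2n,k) = 1` and `((5^k+1)/2) * d ≡ (5^n+1)/2 (mod 5^n - 1)`. Then the power
function `f(x) = x^d` on `F_{5^n}` is PcN for `c = -1`. -/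
theorem stmt_2 (n k d : ℕ) (hn0 : 0 < n) (hk0 : 0 < k) (hd0 : 0 < d)
    (hd : Odd d) (hgcd : Nat.gcd (2 * n) k = 1)
    (hcong : ((5 ^ k + 1) / 2) * d ≡ (5 ^ n + 1) / 2 [MOD 5 ^ n - 1])
    (F : Type*) [Field F] [Fintype F] (hcard : Fintype.card F = 5 ^ n)
    (a b : F) :
    ∃! x : F, (x + a) ^ d + x ^ d = b := by
  haveI : Fact (Nat.Prime 5) := ⟨by norm_num⟩
  haveI : CharP F 5 := charP_of_card_eq_prime_pow hcard
  have hk : Odd k := by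
    have : Nat.Coprime 2 k := Nat.Coprime.coprime_mul_right hgcd
    exact (Nat.coprime_two_left).1 this
  have hn : Odd n := aux_n_odd n k d hk hcong
  obtain ⟨u, hu⟩ := aux_odd_pow k hk
  obtain ⟨w, hw⟩ := aux_odd_pow n hn
  obtain ⟨M, hMe⟩ : ∃ M, M = 60 * (u + w) + 5 := ⟨_, rfl⟩
  have hM : 2 * M = 5 ^ k + 5 ^ n := by omega
  have hMo : Odd M := ⟨30 * (u + w) + 2, by omega⟩
  have hco := aux_coprime n k M hk hn hgcd hM
  have h20 : (2 : F) ≠ 0 := by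
    intro h
    have := (CharP.cast_eq_zero_iff F 5 2).1 (by exact_mod_cast h)
    omega
  have hmod : d * M ≡ 1 [MOD 5 ^ n - 1] := by
    obtain ⟨e, he⟩ := hd
    have e1 : (5 ^ k + 1) / 2 = 60 * u + 3 := by omega
    have e2 : (5 ^ n + 1) / 2 = 60 * w + 3 := by omega
    have e3 : 5 ^ n - 1 = 120 * w + 4 := by omega
    rw [e1, e2, e3] at hcong
    rw [e3]
    have t1 : d * M = (60 * u + 3) * d + ((60 * w + 2) + (120 * w + 4) * e) := by
      rw [hMe, he]; ring
    rw [t1]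
    have t2 := hcong.add_right ((60 * w + 2) + (120 * w + 4) * e)
    refine t2.trans ?_
    have t3 : 60 * w + 3 + (60 * w + 2 + (120 * w + 4) * e) = 1 + (120 * w + 4) * (e + 1) := by
      ring
    rw [t3]
    unfold Nat.ModEq
    rw [Nat.add_mul_mod_self_left]
  have hinv : ∀ x : F, (x ^ d) ^ M = x := by
    intro x
    rw [← pow_mul]
    by_cases hx : x = 0
    · subst hx
      exact zero_pow (Nat.mul_pos hd0 (by omega)).ne'
    · have h1 : x ^ (5 ^ n - 1) = 1 := by
        rw [← hcard]; exact FiniteField.pow_card_sub_one_eq_one x hx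
      have := pow_eq_pow_mod (d * M) h1
      rw [this, hmod, ← pow_eq_pow_mod 1 h1, pow_one]
  have hMinj : Function.Injective (fun x : F => x ^ M) := by
    apply Finite.injective_iff_surjective.2
    exact fun x => ⟨x ^ d, hinv x⟩
  have hdick : ∀ b z z' : F, (z + b) ^ M + z ^ M = (z' + b) ^ M + z' ^ M → z = z' := by
    intro b z z' h
    by_cases hb : b = 0
    · subst hb
      apply hMinj
      simp only [add_zero, ← two_mul] at h
      exact mul_left_cancel₀ h20 h
    · let K := AlgebraicClosure F
      haveI : CharP K 5 := charP_of_injective_algebraMap (algebraMap F K).injective 5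
      obtain ⟨c, hc⟩ : ∃ c, c = b / 2 := ⟨_, rfl⟩
      have hbc : b = 2 * c := by rw [hc]; field_simp
      have hc0 : c ≠ 0 := by rintro rfl; simp at hbc; exact hb hbc
      have r1 : ∀ z : F, (z + b) ^ M + z ^ M
          = c ^ M * ((z / c + 1 + 1) ^ M + (z / c + 1 - 1) ^ M) := by
        intro z
        rw [mul_add, ← mul_pow, ← mul_pow]
        congr 2
        · rw [hbc]; field_simp; ring
        · field_simp; ring
      rw [r1, r1] at h
      have h' := mul_left_cancel₀ (pow_ne_zero M hc0) h
      have hF : ∀ x : F, (algebraMap F K x) ^ 5 ^ n = algebraMap F K x := by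
        intro x
        rw [← map_pow, ← hcard, FiniteField.pow_card]
      have := aux_inj_K n k M hM hco (algebraMap F K (z / c + 1)) (algebraMap F K (z' / c + 1))
        (hF _) (hF _) (by
          have := congrArg (algebraMap F K) h'
          simpa only [map_add, map_sub, map_pow, map_one] using this)
      have h3 := add_right_cancel ((algebraMap F K).injective this)
      exact (div_left_inj' hc0).1 h3
  have hinj : Function.Injective (fun x : F => (x + a) ^ d + x ^ d) := by
    intro x y hxy
    simp only at hxy
    have e : ∀ x : F, (-x ^ d + ((x + a) ^ d + x ^ d)) ^ M + (-x ^ d) ^ M = a := by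
      intro x
      rw [neg_add_cancel_comm_assoc, hMo.neg_pow, hinv, hinv]
      ring
    have h1 := e x
    have h2 := e y
    rw [← hxy] at h2
    have := hdick _ _ _ (h1.trans h2.symm)
    have h3 := congrArg (fun z => z ^ M) (neg_injective this)
    simpa only [hinv] using h3
  exact (Finite.injective_iff_bijective.1 hinj).existsUnique b
end

section
/- Let p be an odd prime and n, k positive integers with p^n ≡ 3 (mod 4), and let d be an even positive integer with d·(p^k+1) ≡ (p^n+1)/2 (mod p^n−1). Then the power function f(x)=x^d on F_{p^n} satisfies _1Δ_f ≤ 3: for every a ∈ F_{p^n} with a ≠ 0 and every b ∈ F_{p^n}, the equation (x+a)^d − x^d = b has at most 3 solutions x ∈ F_{p^n}. -/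
theorem aux_sq_add {F : Type*} [Field F] [Fintype F] (h3 : Fintype.card F % 4 = 3)
    {u v : F} (hu : IsSquare u) (hv : IsSquare v) (h : u + v = 0) : u = 0 ∧ v = 0 := by
  have hn : ¬ IsSquare (-1 : F) := by
    rw [FiniteField.isSquare_neg_one_iff]; simpa using h3
  by_cases hv0 : v = 0
  · subst hv0; simpa using h
  · exfalso; apply hn
    have : (-1 : F) = u / v := by
      rw [eq_div_iff hv0]; linear_combination -h
    rw [this]; exact hu.div hv

theorem aux_lin {F : Type*} [Field F] [Fintype F] (h3 : Fintype.card F % 4 = 3)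
    {Q : ℕ} (hQ : Odd Q) {b t : F} (hb : b ≠ 0) (h : b * t ^ Q + b ^ Q * t = 0) : t = 0 := by
  obtain ⟨m, rfl⟩ := hQ
  have h' : b * t * ((t ^ m) ^ 2 + (b ^ m) ^ 2) = 0 := by
    rw [← h]; ring
  rcases mul_eq_zero.1 h' with h1 | h1
  · simpa [hb] using h1
  · have := (aux_sq_add h3 (IsSquare.sq _) (IsSquare.sq _) h1).2
    exact absurd this (by positivity)

theorem stmt_6 (p n k d : ℕ) (hp : p.Prime) (hodd : Odd p)
    (hn0 : 0 < n) (hk0 : 0 < k) (hd0 : 0 < d) (hd : Even d)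
    (hmod : p ^ n % 4 = 3)
    (hcong : d * (p ^ k + 1) ≡ (p ^ n + 1) / 2 [MOD p ^ n - 1])
    (F : Type*) [Field F] [Fintype F] (hcard : Fintype.card F = p ^ n)
    (a b : F) (ha : a ≠ 0) :
    {x : F | (x + a) ^ d - x ^ d = b}.ncard ≤ 3 := by
  classical
  have : Fact p.Prime := ⟨hp⟩
  have : CharP F p := charP_of_card_eq_prime_pow hcard
  have h3 : Fintype.card F % 4 = 3 := by rw [hcard]; exact hmod
  have h2 : (2 : F) ≠ 0 := by
    apply Ring.two_ne_zero
    intro h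
    rw [ringChar.eq F p] at h
    subst h
    exact absurd hodd (by decide)
  have hadd : ∀ x y : F, (x + y) ^ p ^ k = x ^ p ^ k + y ^ p ^ k := fun x y =>
    add_pow_char_pow x y p k
  have hQ : Odd (p ^ k) := hodd.pow
  have hsq : ∀ x : F, IsSquare (x ^ d) := fun x => hd.isSquare_pow x
  -- the key power identity
  have hkey : ∀ x : F, (x ^ d) ^ (p ^ k + 1) = x ^ ((p ^ n + 1) / 2) := by
    intro x
    rw [← pow_mul]
    by_cases hx : x = 0
    · subst hx
      rw [zero_pow, zero_pow]
      · omega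
      · positivity
    · have h1 : x ^ (p ^ n - 1) = 1 := by
        rw [← hcard]; exact FiniteField.pow_card_sub_one_eq_one x hx
      have h4 := hcong.of_dvd (orderOf_dvd_of_pow_eq_one h1)
      rw [← pow_mod_orderOf x (d * (p ^ k + 1)), h4, pow_mod_orderOf]
  have hkey2 : ∀ x : F, (x ^ d) ^ (p ^ k + 1) * (x ^ d) ^ (p ^ k + 1) = x * x := by
    intro x
    rw [hkey, ← pow_add, show (p ^ n + 1) / 2 + (p ^ n + 1) / 2 = p ^ n + 1 by omega,
      pow_succ, ← hcard, FiniteField.pow_card]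
  have hpm : ∀ x : F, x = (x ^ d) ^ (p ^ k + 1) ∨ x = -(x ^ d) ^ (p ^ k + 1) := fun x =>
    mul_self_eq_mul_self_iff.1 (hkey2 x).symm
  generalize p ^ k = Q at *
  have hone : ∀ s : F, s ^ (Q + 1) = 1 → s = 1 ∨ s = -1 := by
    intro s hs
    have := hkey2 s
    rw [← pow_mul, mul_comm d, pow_mul, hs] at this
    exact mul_self_eq_one_iff.1 (by simpa using this.symm)
  have hpow : ∀ s t : F, s ^ (Q + 1) = t ^ (Q + 1) → s = t ∨ s = -t := by
    intro s t h
    by_cases ht : t = 0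
    · subst ht
      left
      rw [zero_pow (by omega)] at h
      exact pow_eq_zero_iff (by omega) |>.1 h
    · have : (s / t) ^ (Q + 1) = 1 := by
        rw [div_pow, h, div_self (pow_ne_zero _ ht)]
      rcases hone _ this with h1 | h1
      · left; rwa [div_eq_one_iff_eq ht] at h1
      · right; rw [div_eq_iff ht] at h1; simpa using h1
  by_cases hb : b = 0
  · subst hb
    refine le_trans ((Set.ncard_le_one_iff (Set.toFinite _)).2 ?_) (by norm_num : 1 ≤ 3)
    have : ∀ x : F, (x + a) ^ d - x ^ d = 0 → 2 * x = -a := by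
      intro x hx
      have he := sub_eq_zero.1 hx
      have h1 := hkey2 (x + a)
      rw [he, hkey2 x] at h1
      rcases mul_self_eq_mul_self_iff.1 h1 with h | h
      · exact absurd (by linear_combination -h) ha
      · linear_combination h
    intro x y hx hy
    exact mul_left_cancel₀ h2 ((this x hx).trans (this y hy).symm)
  have hneg : ∀ x : F, (-x) ^ Q = -x ^ Q := fun x => hQ.neg_pow x
  let P : F → F → Set F := fun δ ε => {x | (x + a) ^ d - x ^ d = b ∧
    x + a = δ * ((x + a) ^ d) ^ (Q + 1) ∧ x = ε * (x ^ d) ^ (Q + 1)}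
  have hcover : {x : F | (x + a) ^ d - x ^ d = b} ⊆
      (P 1 1 ∪ P (-1) (-1)) ∪ (P 1 (-1) ∪ P (-1) 1) := by
    intro x hx
    simp only [P, Set.mem_union, Set.mem_ofPred_eq, one_mul, neg_one_mul] at hx ⊢
    have := hpm x
    have := hpm (x + a)
    tauto
  -- same signs: linear equation
  have hsame : ∀ δ x : F, δ * δ = 1 → x ∈ P δ δ →
      b * (x ^ d) ^ Q + b ^ Q * x ^ d + b ^ (Q + 1) = δ * a := by
    rintro δ x hδ ⟨h1, h4, h5⟩
    have hu : (x + a) ^ d = x ^ d + b := by linear_combination h1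
    rw [hu, pow_succ, hadd] at h4
    linear_combination (-δ) * h4 + δ * h5 + (-(x ^ d + b) * ((x ^ d) ^ Q + b ^ Q)
      + (x ^ d) ^ (Q + 1)) * hδ
  have hdiff : ∀ δ x : F, δ * δ = 1 → x ∈ P δ (-δ) →
      ((x + a) ^ d + x ^ d) ^ (Q + 1) = 2 * δ * a - b ^ (Q + 1) := by
    rintro δ x hδ ⟨h1, h4, h5⟩
    have e : b = (x + a) ^ d + -x ^ d := by linear_combination -h1
    generalize (x + a) ^ d = u at *
    generalize x ^ d = v at *
    rw [pow_succ, pow_succ, e, hadd, hadd, hneg]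
    linear_combination (-2 * δ) * h4 + 2 * δ * h5 - (2 * u ^ (Q + 1) + 2 * v ^ (Q + 1)) * hδ
  have hA : ∀ δ : F, δ * δ = 1 → (P δ δ).ncard ≤ 1 := by
    intro δ hδ
    rw [Set.ncard_le_one_iff]
    intro x y hx hy
    have e1 := hsame δ x hδ hx
    have e2 := hsame δ y hδ hy
    have := aux_lin h3 hQ hb (t := x ^ d + -y ^ d) (by
      rw [hadd, hneg]; linear_combination e1 - e2)
    have e3 : x ^ d = y ^ d := by linear_combination this
    rw [hx.2.2, hy.2.2, e3]
  have hC : ∀ δ : F, δ * δ = 1 → (P δ (-δ)).ncard ≤ 1 := by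
    intro δ hδ
    rw [Set.ncard_le_one_iff]
    intro x y hx hy
    have e1 := hdiff δ x hδ hx
    have e2 := hdiff δ y hδ hy
    have hx1 := hx.1
    have hy1 := hy.1
    rcases hpow _ _ (e1.trans e2.symm) with h | h
    · have e3 : x ^ d = y ^ d := by
        apply mul_left_cancel₀ h2
        linear_combination h - hx1 + hy1
      rw [hx.2.2, hy.2.2, e3]
    · exfalso
      have e3 : (x + a) ^ d + y ^ d = 0 := by
        apply mul_left_cancel₀ h2
        linear_combination h + hx1 - hy1
      have e4 : (y + a) ^ d + x ^ d = 0 := by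
        linear_combination h - e3
      have e5 := (aux_sq_add h3 (hsq _) (hsq _) e3).1
      have e6 := (aux_sq_add h3 (hsq _) (hsq _) e4).2
      apply hb
      rw [← hx1, e5, e6, sub_zero]
  have hAB : (P 1 1 ∪ P (-1) (-1)).ncard ≤ 1 := by
    by_cases hne : (P 1 1).Nonempty
    · obtain ⟨x, hx⟩ := hne
      have : P (-1) (-1) = ∅ := by
        rw [Set.eq_empty_iff_forall_notMem]
        intro y hy
        have e1 := hsame 1 x (by ring) hx
        have e2 := hsame (-1) y (by ring) hy
        have hx1 := hx.1
        have hy1 := hy.1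
        have := aux_lin h3 hQ hb (t := x ^ d + y ^ d + b) (by
          rw [hadd, hadd]; linear_combination e1 + e2)
        have e3 : (x + a) ^ d + y ^ d = 0 := by linear_combination this + hx1
        have e4 : (y + a) ^ d + x ^ d = 0 := by linear_combination this + hy1
        have e5 := (aux_sq_add h3 (hsq _) (hsq _) e3).1
        have e6 := (aux_sq_add h3 (hsq _) (hsq _) e4).2
        apply hb
        rw [← hx1, e5, e6, sub_zero]
      rw [this, Set.union_empty]
      exact hA 1 (by ring)
    · rw [Set.not_nonempty_iff_eq_empty.1 hne, Set.empty_union]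
      exact hA (-1) (by ring)
  have hC1 := hC 1 (by ring)
  have hC2 := hC (-1) (by ring)
  rw [neg_neg] at hC2
  have l1 := Set.ncard_le_ncard hcover (Set.toFinite _)
  have l2 := Set.ncard_union_le (P 1 1 ∪ P (-1) (-1)) (P 1 (-1) ∪ P (-1) 1)
  have l3 := Set.ncard_union_le (P 1 (-1)) (P (-1) 1)
  omega
end
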